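/- Let A be a commutative monoid, let Aˣ ≤ A denote its submonoid of units, let B' be a commutative monoid in which every element is invertible (i.e. an abelian group), let f : Aˣ → B' be a monoid homomorphism, and let P be the pushout of the diagram B' ← Aˣ → A in the category of commutative monoids (with Aˣ → A the inclusion). Then the canonical map B' → P is injective and its image is exactly the set of units of P. -/

import Mathlib

open CategoryTheory

/-- The congruence on `B × A` whose quotient is the pushout. -/
def pushoutCon {A B : Type*} [CommMonoid A] [CommMonoid B]
    (f : IsUnit.submonoid A →* B) : Con (B × A) where
  r x y := ∃ u : IsUnit.submonoid A, y.2 = u * x.2 ∧ x.1 = y.1 * f u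
  iseqv :=
    { refl := fun x => ⟨1, by simp, by simp⟩
      symm := by
        rintro ⟨b, a⟩ ⟨b', a'⟩ ⟨⟨u, hu⟩, h1, h2⟩
        obtain ⟨v, hv⟩ := hu.exists_left_inv
        have hv' : IsUnit v := IsUnit.of_mul_eq_one u hv
        have key : (⟨u, hu⟩ : IsUnit.submonoid A) * ⟨v, hv'⟩ = 1 :=
          Subtype.ext (by simpa [mul_comm] using hv)
        refine ⟨⟨v, hv'⟩, ?_, ?_⟩
        · simp only at h1 ⊢
          rw [h1, ← mul_assoc, hv, one_mul]
        · simp only at h2 ⊢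
          rw [h2, mul_assoc, ← map_mul, key, map_one, mul_one]
      trans := by
        rintro ⟨b, a⟩ ⟨b', a'⟩ ⟨b'', a''⟩ ⟨u, h1, h2⟩ ⟨v, h3, h4⟩
        simp only at h1 h2 h3 h4
        refine ⟨v * u, ?_, ?_⟩
        · simp [h3, h1, mul_assoc]
        · simp [h2, h4, mul_assoc] }
  mul' := by
    rintro ⟨b, a⟩ ⟨b', a'⟩ ⟨c, d⟩ ⟨c', d'⟩ ⟨u, h1, h2⟩ ⟨v, h3, h4⟩
    simp only at h1 h2 h3 h4
    refine ⟨u * v, ?_, ?_⟩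
    · simp [h3, h1, mul_mul_mul_comm]
    · simp [h2, h4, mul_mul_mul_comm]

/-- let `Aˣ ≤ A` be the submonoid of units of a commutative monoid `A`, let
`B'` be a commutative monoid all of whose elements are invertible, let `f : Aˣ → B'` be a
homomorphism, and let `P` be a pushout of `B' ← Aˣ → A` in commutative monoids. Then the
canonical map `B' → P` is injective and its image is exactly the set of units of `P`. -/
theorem units_cobase_change (A B' : CommMonCat) (hB' : ∀ b : B', IsUnit b)
    (f : CommMonCat.of (IsUnit.submonoid A) ⟶ B')
    (P : CommMonCat) (inB : B' ⟶ P) (inA : A ⟶ P)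
    (hpo : IsPushout f (CommMonCat.ofHom (IsUnit.submonoid A).subtype) inB inA) :
    Function.Injective inB ∧ ∀ p : P, IsUnit p ↔ ∃ b : B', inB b = p := by
  have hw : ∀ u : IsUnit.submonoid A, inB (f u) = inA (u : A) := fun u =>
    ConcreteCategory.congr_hom hpo.w u
  let c : Con (B' × A) := pushoutCon f.hom
  let jB : B' →* c.Quotient := c.mk'.comp (MonoidHom.inl B' A)
  let jA : A →* c.Quotient := c.mk'.comp (MonoidHom.inr B' A)
  have hj : f ≫ CommMonCat.ofHom jB =
      CommMonCat.ofHom (IsUnit.submonoid A).subtype ≫ CommMonCat.ofHom jA := by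
    ext u
    change ((f u, 1) : B' × A) = (((1, (u : A)) : B' × A) : c.Quotient)
    refine (Con.eq c).2 ⟨u, ?_, ?_⟩
    · simp
    · exact (one_mul _).symm
  let d : P ⟶ CommMonCat.of c.Quotient := hpo.desc _ _ hj
  have dB : ∀ b, d (inB b) = (((b, 1) : B' × A) : c.Quotient) := fun b =>
    ConcreteCategory.congr_hom (hpo.inl_desc _ _ hj) b
  have dA : ∀ a, d (inA a) = (((1, a) : B' × A) : c.Quotient) := fun a =>
    ConcreteCategory.congr_hom (hpo.inr_desc _ _ hj) a
  let e : c.Quotient →* P := c.lift (inB.hom.coprod inA.hom) (by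
    rintro ⟨b, a⟩ ⟨b', a'⟩ ⟨u, h1, h2⟩
    simp only at h1 h2
    subst h1 h2
    change inB (b' * f u) * inA a = inB b' * inA (u * a)
    rw [map_mul, map_mul, hw, mul_assoc])
  have he : ∀ b a, e (((b, a) : B' × A) : c.Quotient) = inB b * inA a := fun b a => rfl
  have hde : d ≫ CommMonCat.ofHom e = 𝟙 P := by
    apply hpo.hom_ext
    · ext b
      change e (d (inB b)) = inB b
      rw [dB, he, map_one, mul_one]
    · ext a
      change e (d (inA a)) = inA a
      rw [dA, he, map_one, one_mul]
  have hsurj : ∀ p : P, ∃ b a, p = inB b * inA a := by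
    intro p
    have h : e (d p) = p := ConcreteCategory.congr_hom hde p
    obtain ⟨⟨b, a⟩, hq⟩ := Con.mk'_surjective (c := c) (d p)
    refine ⟨b, a, ?_⟩
    rw [← he, ← h]
    exact congrArg e hq.symm
  refine ⟨?_, fun p => ⟨fun hp => ?_, ?_⟩⟩
  · intro b b' h
    have h' := congrArg d h
    rw [dB, dB] at h'
    obtain ⟨u, h1, h2⟩ := (Con.eq c).1 h'
    have hu : u = 1 := Subtype.ext (by simpa using h1.symm)
    subst hu
    simpa using h2
  · obtain ⟨q, hq⟩ := hp.exists_right_inv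
    obtain ⟨b, a, rfl⟩ := hsurj p
    obtain ⟨b', a', rfl⟩ := hsurj q
    have h' : inB (b * b') * inA (a * a') = 1 := by
      rw [map_mul, map_mul, mul_mul_mul_comm, hq]
    have h2 := congrArg d h'
    rw [map_mul, dB, dA, map_one] at h2
    obtain ⟨u, h3, -⟩ := (Con.eq c (a := ((b * b', 1) * (1, a * a') : B' × A)) (b := 1)).1 h2
    have h4 : a * (u * a') = 1 := by
      have : (1 : A) = u * (1 * (a * a')) := h3
      rw [this, one_mul, mul_left_comm]
    have ha : IsUnit a := IsUnit.of_mul_eq_one _ h4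
    exact ⟨b * f ⟨a, ha⟩, by rw [map_mul, hw]⟩
  · rintro ⟨b, rfl⟩
    exact (hB' b).map inB.hom
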